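/- arXiv:1707.08662 — 3 statements merged into one kernel-verified Lean document; each statement's English description precedes it below -/
import Mathlib

section
/- Let p be an odd prime. Every regular partial difference set in an Abelian group of order 8p^3 is trivial. -/
variable {G : Type*} [CommGroup G] [DecidableEq G] [Fintype G]

/-- The number of representations of `g` as `d₁ * d₂⁻¹` with `d₁, d₂ ∈ D`, `d₁ ≠ d₂`. -/
def pdsReps (D : Finset G) (g : G) : ℕ :=
  ((D ×ˢ D).filter (fun x => x.1 ≠ x.2 ∧ x.1 * x.2⁻¹ = g)).card

/-- `D` is a `(v,k,λ,μ)`-partial difference set in `G`. -/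
def IsPDS (D : Finset G) (v k l m : ℕ) : Prop :=
  Fintype.card G = v ∧ D.card = k ∧
  (∀ g : G, g ≠ 1 → g ∈ D → pdsReps D g = l) ∧
  (∀ g : G, g ≠ 1 → g ∉ D → pdsReps D g = m)

/-- `D` is regular: closed under inverses and not containing the identity. -/
def IsRegularPDS (D : Finset G) : Prop :=
  (∀ d ∈ D, d⁻¹ ∈ D) ∧ (1 : G) ∉ D

/-- A regular PDS is trivial if `D ∪ {e}` or `G \ D` is a subgroup. -/
def IsTrivialPDS (D : Finset G) : Prop :=
  (∃ H : Subgroup G, (H : Set G) = ↑D ∪ {1}) ∨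
  (∃ H : Subgroup G, (H : Set G) = (↑D : Set G)ᶜ)

section Arithmetic

/-- If `q` divides one of `s`, `s - 1`, then `s` keeps distance about `q` from both ends of
`[1, N]`, unless it is an endpoint. -/
theorem mul_le_of_dvd_or_dvd {q N s : ℤ} (hN : q ∣ N) (hs : q ∣ s ∨ q ∣ s - 1)
    (h1 : 1 < s) (h2 : s < N) : q ≤ s ∧ s ≤ N + 1 - q := by
  rcases hs with h | h
  · have h3 := Int.le_of_dvd (by lia) h
    have h4 := Int.le_of_dvd (by lia) (dvd_sub hN h)
    constructor <;> lia
  · have h3 := Int.le_of_dvd (by lia) h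
    have h4 := Int.le_of_dvd (by lia) (show q ∣ N - s + 1 by
      have := dvd_sub hN h
      rwa [show N - (s - 1) = N - s + 1 by ring] at this)
    constructor <;> lia

theorem pow_dvd_or_dvd_sub_one {p : ℕ} (hp : p.Prime) (hodd : Odd p) {i j : ℕ} {s : ℤ}
    (h : (p : ℤ) ^ j ∣ 2 ^ i * (s * (s - 1))) : (p : ℤ) ^ j ∣ s ∨ (p : ℤ) ^ j ∣ s - 1 := by
  have hpi : Prime (p : ℤ) := Nat.prime_iff_prime_int.1 hp
  have h2 : ¬ (p : ℤ) ∣ 2 ^ i := fun hd ↦ by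
    have h3 : p ∣ 2 := by exact_mod_cast hpi.dvd_of_dvd_pow hd
    have := (Nat.prime_dvd_prime_iff_eq hp Nat.prime_two).1 h3
    subst this
    exact absurd hodd (by decide)
  have h3 := hpi.pow_dvd_of_dvd_mul_left j h2 h
  by_cases hs : (p : ℤ) ∣ s
  · left
    refine hpi.pow_dvd_of_dvd_mul_right j (fun h4 ↦ ?_) h3
    exact hpi.not_dvd_one (by simpa using dvd_sub hs h4)
  · exact .inr (hpi.pow_dvd_of_dvd_mul_left j hs h3)

/-- The discriminant of the quadratic satisfied by `θ` bounds `s * (N + 1 - s)`. -/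
theorem four_mul_le_of_quadratic {q N δ s θ μ : ℤ} (hδ : 0 < δ) (hN : 0 < N)
    (hμ : μ = θ + δ * s + θ * (θ + δ)) (hμs : δ * (s * (s - 1)) = μ * N)
    (h1 : q ≤ s) (h2 : s ≤ N + 1 - q) :
    4 * δ * (q * (N + 1 - q)) ≤ (δ + 1) ^ 2 * N := by
  have h3 : 0 ≤ (s - q) * (N + 1 - q - s) := mul_nonneg (by linarith) (by linarith)
  have h4 : 4 * (δ * s - μ) ≤ (δ + 1) ^ 2 := by nlinarith [sq_nonneg (2 * θ + δ + 1)]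
  have h5 := mul_le_mul_of_nonneg_right h4 hN.le
  have h6 : 4 * (δ * s - μ) * N = 4 * δ * (s * (N + 1 - s)) := by linear_combination 4 * hμs
  have h7 : 0 ≤ 4 * δ * ((s - q) * (N + 1 - q - s)) := by positivity
  nlinarith

theorem trivial_of_eight_dvd {p θ d : ℤ} (hp : 3 ≤ p) (h1 : -(8 * p) ≤ θ) (h2 : θ ≤ -1)
    (hd0 : 0 ≤ d) (hd7 : d ≤ 7)
    (hQ : d ^ 2 - (8 + (2 * θ + 8 * p)) * d - 7 * (θ * (θ + 8 * p)) ≤ 0) :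
    θ = -1 ∨ θ = -(8 * p) := by
  by_contra! h
  obtain ⟨x, hx⟩ : ∃ x, x = θ + 8 * p := ⟨_, rfl⟩
  obtain ⟨z, hz⟩ : ∃ z, z = -θ := ⟨_, rfl⟩
  have hx1 : 1 ≤ x := by lia
  have hz2 : 2 ≤ z := by lia
  have hxz : 24 ≤ x + z := by lia
  have hQ' : 7 * (x * z) ≤ d * (8 - d) + d * (x - z) := by
    have : θ = -z := by lia
    have h8 : 8 * p = x + z := by lia
    rw [h8, this] at hQ
    nlinarith
  have hd : d * (8 - d) ≤ 16 := by nlinarith [sq_nonneg (d - 4)]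
  have h7 : d * (x - z) ≤ 7 * x := by nlinarith
  have hx2 : x ≤ 2 := by nlinarith
  nlinarith

theorem false_of_eq_left {p θ d μ s : ℤ} (hp : 3 ≤ p) (hs : s = p ∨ s = p + 1)
    (hμ : μ = θ + 4 * p * s + θ * (θ + 4 * p)) (hμs : 4 * p * (s * (s - 1)) = μ * (2 * p ^ 2))
    (hQ : d ^ 2 - (8 + (2 * θ + 4 * p)) * d - 7 * (θ * (θ + 4 * p)) ≤
      4 * (θ + 4 * p * s - d)) : False := by
  obtain ⟨u, hu⟩ : ∃ u, u = θ + 2 * p := ⟨_, rfl⟩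
  obtain rfl : θ = u - 2 * p := by lia
  have hp2 : 2 * p ^ 2 ≠ 0 := by positivity
  have hd := sq_nonneg (d - (u + 2))
  rcases hs with rfl | rfl
  · have hμ' : μ = 2 * (s - 1) := by
      apply mul_right_cancel₀ hp2
      linear_combination -hμs
    have hu2 : u ^ 2 + u = 4 * s - 2 := by linear_combination hμ' - hμ
    nlinarith
  · have hμ' : μ = 2 * (p + 1) := by
      apply mul_right_cancel₀ hp2
      linear_combination -hμs
    have hu2 : u ^ 2 + u = 2 := by linear_combination hμ' - hμ
    nlinarith

theorem false_of_four_dvd {p θ d μ s : ℤ} (hp : 3 ≤ p)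
    (h1 : 1 < s) (h2 : s < 2 * p ^ 2) (hps : p ∣ s ∨ p ∣ s - 1)
    (hμ : μ = θ + 4 * p * s + θ * (θ + 4 * p)) (hμs : 4 * p * (s * (s - 1)) = μ * (2 * p ^ 2))
    (hQ : d ^ 2 - (8 + (2 * θ + 4 * p)) * d - 7 * (θ * (θ + 4 * p)) ≤
      4 * (θ + 4 * p * s - d))
    (hQ' : d ^ 2 - (8 + (2 * θ + 4 * p)) * d - 7 * (θ * (θ + 4 * p)) ≤
      4 * (8 * p ^ 3 - 8 - (θ + 4 * p * s) + d)) : False := by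
  have hN : 0 < 2 * p ^ 2 := by positivity
  have hdvd : p ∣ 2 * p ^ 2 := ⟨2 * p, by ring⟩
  have key : ∀ s', p ∣ s' ∨ p ∣ s' - 1 → 1 < s' → s' < 2 * p → s' = p ∨ s' = p + 1 := by
    rintro s' (⟨t, rfl⟩ | ⟨t, ht⟩) h3 h4
    · have h5 : t < 2 := by nlinarith
      have h6 : 0 < t := by nlinarith
      obtain rfl : t = 1 := by lia
      left; ring
    · have h5 : t < 2 := by nlinarith
      have h6 : 0 < t := by nlinarith
      obtain rfl : t = 1 := by lia
      right; lia
  rcases lt_or_ge s (2 * p) with h | h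
  · exact false_of_eq_left hp (key s hps h1 h) hμ hμs hQ
  rcases le_or_gt s (2 * p ^ 2 + 1 - 2 * p) with h' | h'
  · have := four_mul_le_of_quadratic (by positivity) hN hμ hμs h h'
    nlinarith
  · have hs' := key (2 * p ^ 2 + 1 - s) (by
      rcases hps with h3 | h3
      · right
        have := dvd_sub hdvd h3
        rwa [show 2 * p ^ 2 + 1 - s - 1 = 2 * p ^ 2 - s by ring]
      · left
        have := dvd_sub hdvd h3
        rwa [show 2 * p ^ 2 + 1 - s = 2 * p ^ 2 - (s - 1) by ring]) (by lia) (by lia)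
    refine false_of_eq_left (θ := -1 - (θ + 4 * p)) (d := 7 - d)
      (μ := 8 * p ^ 3 - 2 * (θ + 4 * p * s) + μ + (2 * θ + 4 * p)) hp hs' ?_ ?_ ?_
    · linear_combination hμ
    · linear_combination hμs
    · linear_combination hQ'

/-- The arithmetic constraints on a partial difference set with `2θ + δ = λ - μ` and
`δ = 2 ^ i * p ^ j`, `j ≤ 1`, having `d` elements in the Sylow `2`-subgroup, force it to be
trivial. -/
theorem endpoint_of_constraints {p : ℕ} (hp : p.Prime) (hodd : Odd p) {i j : ℕ} (hi : i ≤ 3)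
    (hj : j ≤ 1) {N δ s θ μ d : ℤ} (hδ : δ = 2 ^ i * (p : ℤ) ^ j) (hN : δ * N = 8 * (p : ℤ) ^ 3)
    (hs1 : 1 ≤ s) (hsN : s ≤ N) (hθ1 : θ ≤ -1) (hθδ : -δ ≤ θ) (hd0 : 0 ≤ d) (hd7 : d ≤ 7)
    (hμ : μ = θ + δ * s + θ * (θ + δ)) (hμs : δ * (s * (s - 1)) = μ * N)
    (hQ : d ^ 2 - (8 + (2 * θ + δ)) * d - 7 * (θ * (θ + δ)) ≤
      (8 - 2 ^ i) * (θ + δ * s - d))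
    (hQ' : d ^ 2 - (8 + (2 * θ + δ)) * d - 7 * (θ * (θ + δ)) ≤
      (8 - 2 ^ i) * (8 * (p : ℤ) ^ 3 - 8 - (θ + δ * s) + d)) :
    s = 1 ∨ s = N ∨ θ = -1 ∨ θ = -δ := by
  by_contra! h
  obtain ⟨h1, h2, h3, h4⟩ := h
  have hp3 : (3 : ℤ) ≤ p := by
    have := hp.two_le
    have : p ≠ 2 := by rintro rfl; exact absurd hodd (by decide)
    lia
  have hP : (27 : ℤ) ≤ (p : ℤ) ^ 3 := by
    calc (27 : ℤ) = 3 ^ 3 := by norm_num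
      _ ≤ _ := by gcongr
  have hδ0 : 0 < δ := by lia
  have hN0 : 0 < N := by lia
  have hN' : N = 2 ^ (3 - i) * (p : ℤ) ^ (3 - j) := by
    apply mul_left_cancel₀ hδ0.ne'
    rw [hN, hδ, show (2 : ℤ) ^ i * p ^ j * (2 ^ (3 - i) * p ^ (3 - j)) =
      (2 ^ i * 2 ^ (3 - i)) * (p ^ j * p ^ (3 - j)) by ring, ← pow_add, ← pow_add,
      Nat.add_sub_cancel' hi, Nat.add_sub_cancel' (by lia)]
    norm_num
  have hdvd : (p : ℤ) ^ (3 - 2 * j) ∣ 2 ^ i * (s * (s - 1)) := by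
    have hpj : (p : ℤ) ^ j ≠ 0 := by positivity
    refine ⟨μ * 2 ^ (3 - i), mul_left_cancel₀ hpj ?_⟩
    rw [hδ, hN'] at hμs
    have : (p : ℤ) ^ (3 - j) = p ^ j * p ^ (3 - 2 * j) := by
      rw [← pow_add]; congr 1; lia
    rw [this] at hμs
    linear_combination hμs
  have hdvd' := pow_dvd_or_dvd_sub_one hp hodd hdvd
  have hdN : (p : ℤ) ^ (3 - 2 * j) ∣ N := by
    rw [hN']
    exact Dvd.dvd.mul_left (pow_dvd_pow _ (by lia)) _
  have hs1' : 1 < s := by lia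
  have hsN' : s < N := by lia
  obtain ⟨h5, h6⟩ := mul_le_of_dvd_or_dvd hdN hdvd' hs1' hsN'
  have hdisc := four_mul_le_of_quadratic hδ0 hN0 hμ hμs h5 h6
  interval_cases j
  · simp only [mul_zero, Nat.sub_zero, pow_zero, mul_one] at *
    subst hδ hN'
    clear hQ hQ'
    interval_cases i <;> norm_num at * <;> nlinarith
  · simp only [mul_one, pow_one, Nat.reduceSub] at *
    subst hδ hN'
    interval_cases i
    · clear hQ hQ'
      norm_num at *
      nlinarith
    · clear hQ hQ'
      norm_num at *
      nlinarith
    · norm_num at *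
      exact false_of_four_dvd (by exact_mod_cast hp3) hs1' hsN' hdvd' hμ hμs (d := d)
        (by linarith) (by linarith)
    · norm_num at *
      have := trivial_of_eight_dvd (by exact_mod_cast hp3) hθδ hθ1 hd0 hd7 (by linarith)
      lia

end Arithmetic

section Fourier

theorem int_dvd_of_isIntegral {x : ℂ} (hx : IsIntegral ℤ x) {d n : ℤ} (h : (d : ℂ) * x = n) :
    d ∣ n := by
  rcases eq_or_ne d 0 with rfl | hd
  · have : (n : ℂ) = 0 := by simpa using h.symm
    simp [Int.cast_eq_zero.1 this]
  have hx' : x = algebraMap ℚ ℂ (n / d) := by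
    have : (d : ℂ) ≠ 0 := by exact_mod_cast hd
    simp only [eq_ratCast, Rat.cast_div, Rat.cast_intCast]
    field_simp
    linear_combination h
  rw [hx', isIntegral_algebraMap_iff (algebraMap ℚ ℂ).injective,
    IsIntegrallyClosed.isIntegral_iff] at hx
  obtain ⟨y, hy⟩ := hx
  refine ⟨y, ?_⟩
  have : (d : ℚ) ≠ 0 := by exact_mod_cast hd
  rw [eq_div_iff this] at hy
  have hy' : ((y * d : ℤ) : ℚ) = n := by simpa using hy
  rw [mul_comm]
  exact_mod_cast hy'.symm

variable {B : Type*} [AddCommGroup B] [Fintype B]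

theorem AddChar.isIntegral_apply (χ : AddChar B ℂ) (b : B) : IsIntegral ℤ (χ b) := by
  refine IsIntegral.of_pow Fintype.card_pos (n := Fintype.card B) ?_
  rw [← AddChar.map_nsmul_eq_pow, card_nsmul_eq_zero, AddChar.map_zero_eq_one]
  exact isIntegral_one

theorem AddChar.sum_charSum_mul (c : B → ℂ) (b : B) :
    ∑ χ : AddChar B ℂ, (∑ a, c a * χ a) * χ (-b) = Fintype.card B * c b := by
  classical
  simp_rw [Finset.sum_mul, mul_assoc, ← AddChar.map_add_eq_mul]
  rw [Finset.sum_comm]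
  simp_rw [← Finset.mul_sum, AddChar.sum_apply_eq_ite, ← sub_eq_add_neg, sub_eq_zero]
  simp [mul_comm]

/-- The integer-valued function `c` has total sum `k`, and its Fourier coefficients at the
nontrivial characters are `θ + δ` on `E` and `θ` outside of `E`. -/
structure TwoValuedTransform (c : B → ℤ) (E : Finset (AddChar B ℂ)) (k θ δ : ℤ) : Prop where
  zero_notMem : 0 ∉ E
  sum_eq : ∑ b, c b = k
  charSum_eq : ∀ χ : AddChar B ℂ, χ ≠ 0 →
    ∑ b, (c b : ℂ) * χ b = θ + δ * (E : Set (AddChar B ℂ)).indicator 1 χ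

namespace TwoValuedTransform

variable {c : B → ℤ} {E : Finset (AddChar B ℂ)} {k θ δ : ℤ}

theorem charSum_eq' (h : TwoValuedTransform c E k θ δ) (χ : AddChar B ℂ) :
    ∑ b, (c b : ℂ) * χ b = θ + δ * (E : Set (AddChar B ℂ)).indicator 1 χ +
      (k - θ) * if χ = 0 then 1 else 0 := by
  by_cases hχ : χ = 0
  · subst hχ
    have := h.zero_notMem
    simp [this, ← h.sum_eq]
  · simp [hχ, h.charSum_eq χ hχ]

theorem inversion (h : TwoValuedTransform c E k θ δ) [DecidableEq B] (b : B) :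
    (Fintype.card B : ℂ) * c b =
      k - θ + (if b = 0 then (Fintype.card B : ℂ) * θ else 0) + δ * ∑ χ ∈ E, χ (-b) := by
  rw [← AddChar.sum_charSum_mul (fun b ↦ (c b : ℂ)) b]
  simp_rw [h.charSum_eq', add_mul, Finset.sum_add_distrib, mul_assoc, ← Finset.mul_sum]
  rw [AddChar.sum_apply_eq_ite]
  simp [Set.indicator_apply, Finset.sum_ite_mem]
  split_ifs <;> ring

theorem card_mul_apply_zero (h : TwoValuedTransform c E k θ δ) :
    (Fintype.card B : ℤ) * c 0 = k + (Fintype.card B - 1) * θ + δ * E.card := by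
  classical
  have := h.inversion 0
  simp at this
  have h2 : (((Fintype.card B : ℤ) * c 0 : ℤ) : ℂ) =
    ((k + (Fintype.card B - 1) * θ + δ * E.card : ℤ) : ℂ) := by
    push_cast
    rw [this]; ring
  exact_mod_cast h2

theorem parseval (h : TwoValuedTransform c E k θ δ) :
    (Fintype.card B : ℤ) * ∑ b, c b ^ 2 =
      k ^ 2 + (Fintype.card B - 1) * θ ^ 2 + E.card * (2 * θ * δ + δ ^ 2) := by
  classical
  have h1 (χ : AddChar B ℂ) : ∑ b, (c b : ℂ) * χ (-b) = ∑ b, (c b : ℂ) * χ b := by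
    have : ∑ b, (c b : ℂ) * χ (-b) = starRingEnd ℂ (∑ b, (c b : ℂ) * χ b) := by
      simp [AddChar.map_neg_eq_conj]
    rw [this, h.charSum_eq']
    simp [Set.indicator_apply]
    split_ifs <;> simp
  have h2 : (Fintype.card B : ℂ) * ∑ b, (c b : ℂ) ^ 2 =
      ∑ χ : AddChar B ℂ, (∑ b, (c b : ℂ) * χ b) ^ 2 := by
    have : ∀ b, (Fintype.card B : ℂ) * (c b : ℂ) ^ 2 =
        ∑ χ : AddChar B ℂ, (∑ a, (c a : ℂ) * χ a) * (c b * χ (-b)) := fun b ↦ by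
      rw [sq, ← mul_assoc, ← AddChar.sum_charSum_mul (fun b ↦ (c b : ℂ)) b, Finset.sum_mul]
      exact Finset.sum_congr rfl fun _ _ ↦ by ring
    rw [Finset.mul_sum, Finset.sum_congr rfl fun b _ ↦ this b, Finset.sum_comm]
    simp_rw [← Finset.mul_sum, h1, sq]
  have h3 (χ : AddChar B ℂ) : (∑ b, (c b : ℂ) * χ b) ^ 2 =
      θ ^ 2 + (2 * θ * δ + δ ^ 2) * (E : Set (AddChar B ℂ)).indicator 1 χ +
      (k ^ 2 - θ ^ 2) * if χ = 0 then 1 else 0 := by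
    rw [h.charSum_eq']
    have := h.zero_notMem
    by_cases hχ : χ = 0
    · subst hχ; simp [this]
    · by_cases hE : χ ∈ E <;> (simp [hχ, hE]; try ring)
  simp_rw [h3, Finset.sum_add_distrib, ← Finset.mul_sum] at h2
  simp [Set.indicator_apply, Finset.sum_ite_mem] at h2
  have h4 : (((Fintype.card B : ℤ) * ∑ b, c b ^ 2 : ℤ) : ℂ) =
      ((k ^ 2 + (Fintype.card B - 1) * θ ^ 2 + E.card * (2 * θ * δ + δ ^ 2) : ℤ) : ℂ) := by
    push_cast
    rw [h2]; ring
  exact_mod_cast h4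

theorem dvd_card_mul_sub (h : TwoValuedTransform c E k θ δ) {b : B} (hb : b ≠ 0) :
    δ ∣ Fintype.card B * c b - (k - θ) := by
  classical
  refine int_dvd_of_isIntegral (x := ∑ χ ∈ E, χ (-b))
    (IsIntegral.sum _ fun χ _ ↦ χ.isIntegral_apply (-b)) ?_
  have := h.inversion b
  simp [hb] at this
  push_cast
  rw [this]; ring

theorem map (h : TwoValuedTransform c E k θ δ) {C : Type*} [AddCommGroup C] [Fintype C]
    [DecidableEq C] (π : B →+ C) (hπ : Function.Surjective π) :
    TwoValuedTransform (fun x ↦ ∑ b with π b = x, c b)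
      (Finset.univ.filter fun χ : AddChar C ℂ ↦ χ.compAddMonoidHom π ∈ E) k θ δ where
  zero_notMem := by
    have : (0 : AddChar C ℂ).compAddMonoidHom π = 0 := rfl
    simpa [this] using h.zero_notMem
  sum_eq := by
    rw [← h.sum_eq]
    exact Finset.sum_fiberwise _ _ _
  charSum_eq χ hχ := by
    have hχ' : χ.compAddMonoidHom π ≠ 0 := fun h0 ↦
      hχ (AddChar.compAddMonoidHom_injective_left π hπ h0)
    have h1 := h.charSum_eq _ hχ'
    rw [← Finset.sum_fiberwise _ π] at h1
    simp only [Set.indicator_apply, Finset.mem_coe, Finset.mem_filter, Finset.mem_univ,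
      true_and, Pi.one_apply] at h1 ⊢
    rw [← h1]
    refine Finset.sum_congr rfl fun x _ ↦ ?_
    rw [Int.cast_sum, Finset.sum_mul]
    refine Finset.sum_congr rfl fun b hb ↦ ?_
    simp [(Finset.mem_filter.1 hb).2]

end TwoValuedTransform
end Fourier

section Core

open Finset

namespace TwoValuedTransform

variable {A : Type*} [AddCommGroup A] [Fintype A] {c : A → ℤ} {E : Finset (AddChar A ℂ)}
  {k θ δ s N : ℤ}

theorem sum_sq_eq (h : TwoValuedTransform c E k θ δ) :
    (Fintype.card A : ℤ) * ∑ a, c a ^ 2 = (k - θ) * (k - θ - δ) +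
      Fintype.card A * ((2 * θ + δ) * c 0 - θ * (θ + δ)) := by
  linear_combination h.parseval - (2 * θ + δ) * h.card_mul_apply_zero

theorem mul_sub_one_eq (h : TwoValuedTransform c E k θ δ) (hc : ∀ a, c a = 0 ∨ c a = 1)
    (hc0 : c 0 = 0) (hδ : δ ≠ 0) (hN : δ * N = Fintype.card A) (hk : k = θ + δ * s) :
    δ * (s * (s - 1)) = (θ + δ * s + θ * (θ + δ)) * N := by
  have h1 : ∑ a, c a ^ 2 = k := by
    rw [← h.sum_eq]
    refine sum_congr rfl fun a _ ↦ ?_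
    rcases hc a with h | h <;> simp [h]
  have h2 := h.sum_sq_eq
  rw [h1, hc0, ← hN] at h2
  apply mul_left_cancel₀ hδ
  subst hk
  linear_combination -h2

/-- The set of characters where the transform takes its larger value is itself the support of a
function with a two-valued transform on the dual group. -/
theorem dual (h : TwoValuedTransform c E k θ δ) (hc : ∀ a, c a = 0 ∨ c a = 1)
    (hc0 : c 0 = 0) (hδ : δ ≠ 0) (hN : δ * N = Fintype.card A) (hk : k = θ + δ * s) :
    ∃ E' : Finset (AddChar (AddChar A ℂ) ℂ),
      TwoValuedTransform (fun χ ↦ if χ ∈ E then 1 else 0) E' (-s + N * -θ) (-s) N := by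
  classical
  refine ⟨univ.filter fun Ψ ↦ c (-(AddChar.doubleDualEquiv.symm Ψ)) = 1, ?_, ?_, ?_⟩
  · simp [hc0]
  · have h1 := h.card_mul_apply_zero
    rw [hc0, ← hN, hk] at h1
    simp only [sum_boole, filter_mem_eq_inter, univ_inter]
    apply mul_left_cancel₀ hδ
    linear_combination -h1
  · intro Ψ hΨ
    obtain ⟨a, rfl⟩ := AddChar.doubleDualEquiv.surjective Ψ
    have ha : a ≠ 0 := by rintro rfl; simp at hΨ
    have h1 := h.inversion (-a)
    have hδ' : (δ : ℂ) ≠ 0 := by exact_mod_cast hδ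
    have hN' : (δ : ℂ) * N = Fintype.card A := by exact_mod_cast hN
    have hk' : (k : ℂ) = θ + δ * s := by exact_mod_cast hk
    simp only [neg_eq_zero, ha, if_false, neg_neg, ← hN', hk'] at h1
    have h2 : ∑ χ : AddChar A ℂ, ((if χ ∈ E then 1 else 0 : ℤ) : ℂ) *
        AddChar.doubleDualEquiv a χ = ∑ χ ∈ E, χ a := by
      simp [AddChar.coe_doubleDualEquiv, sum_ite_mem]
    have h4 : (c (-a) : ℂ) = ((univ.filter fun Ψ : AddChar (AddChar A ℂ) ℂ ↦
        c (-(AddChar.doubleDualEquiv.symm Ψ)) = 1 : Finset _) : Set _).indicator 1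
        (AddChar.doubleDualEquiv a) := by
      rcases hc (-a) with h3 | h3 <;> simp [h3, -AddChar.coe_doubleDualEquiv]
    rw [h2, ← h4]
    apply mul_left_cancel₀ hδ'
    push_cast
    linear_combination -h1

theorem sum_le_of_forall_ne_zero {C : Type*} [Fintype C] [Zero C] {F : C → ℤ}
    (hF : ∀ x, x ≠ 0 → F x ≤ 0) : ∑ x, F x ≤ F 0 := by
  classical
  rw [← add_sum_erase _ _ (mem_univ 0)]
  have : ∑ x ∈ univ.erase 0, F x ≤ 0 := sum_nonpos fun x hx ↦ hF x (ne_of_mem_erase hx)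
  linarith

/-- The counting constraints coming from the cosets of a subgroup of order `8`. -/
theorem coset_constraints {p : ℕ} (hp : p.Prime) (hodd : Odd p)
    (hcard : Fintype.card A = 8 * p ^ 3)
    (h : TwoValuedTransform c E k θ δ) (hc : ∀ a, c a = 0 ∨ c a = 1) (hc0 : c 0 = 0)
    {i : ℕ} (hi : i ≤ 3) (hiδ : 2 ^ i ∣ δ) (hδ : δ ≠ 0) (hN : δ * N = Fintype.card A)
    (hk : k = θ + δ * s) :
    ∃ d : ℤ, 0 ≤ d ∧ d ≤ 7 ∧
      d ^ 2 - (8 + (2 * θ + δ)) * d - 7 * (θ * (θ + δ)) ≤ (8 - 2 ^ i) * (θ + δ * s - d) ∧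
      d ^ 2 - (8 + (2 * θ + δ)) * d - 7 * (θ * (θ + δ)) ≤
        (8 - 2 ^ i) * (8 * (p : ℤ) ^ 3 - 8 - (θ + δ * s) + d) := by
  classical
  have hp0 : 0 < p ^ 3 := pow_pos hp.pos 3
  obtain ⟨H, hH⟩ : ∃ H : AddSubgroup A, Nat.card H = 8 := by
    have : Fact (Nat.Prime 2) := ⟨Nat.prime_two⟩
    obtain ⟨K, hK⟩ := Sylow.exists_subgroup_card_pow_prime (G := Multiplicative A) 2 (n := 3) (by
      rw [Nat.card_eq_fintype_card, Fintype.card_multiplicative, hcard]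
      exact ⟨p ^ 3, by norm_num⟩)
    exact ⟨AddSubgroup.toSubgroup.symm K, hK⟩
  let C := A ⧸ H
  let π : A →+ C := QuotientAddGroup.mk' H
  have hπ : Function.Surjective π := QuotientAddGroup.mk'_surjective H
  have hC : Fintype.card C = p ^ 3 := by
    have := AddSubgroup.card_eq_card_quotient_mul_card_addSubgroup H
    rw [hH, Nat.card_eq_fintype_card, Nat.card_eq_fintype_card, hcard, mul_comm] at this
    exact (Nat.eq_of_mul_eq_mul_right (by norm_num) this).symm
  have hfib (x : C) : (univ.filter fun a ↦ π a = x).card = 8 := by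
    have h1 : ∑ y : C, (univ.filter fun a ↦ π a = y).card = Fintype.card A :=
      (card_eq_sum_card_fiberwise fun _ _ ↦ mem_univ _).symm
    rw [sum_congr rfl fun y _ ↦ AddMonoidHom.card_fiber_eq_of_mem_range π (hπ y) (hπ x), sum_const,
      card_univ, hC, hcard, smul_eq_mul, mul_comm] at h1
    exact Nat.eq_of_mul_eq_mul_right hp0 h1
  have hf := h.map π hπ
  set f : C → ℤ := fun x ↦ ∑ a with π a = x, c a with hfdef
  have hf0 (x : C) : 0 ≤ f x := sum_nonneg fun a _ ↦ by rcases hc a with h | h <;> simp [h]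
  have hf8 (x : C) : f x ≤ 8 := by
    have := sum_le_card_nsmul (univ.filter fun a ↦ π a = x) c 1 fun a _ ↦ by
      rcases hc a with h | h <;> simp [h]
    simpa [hfib x] using this
  have hf7 : f 0 ≤ 7 := by
    have h0 : (0 : A) ∈ univ.filter fun a ↦ π a = 0 := by simp
    have := sum_le_card_nsmul ((univ.filter fun a ↦ π a = 0).erase 0) c 1 fun a _ ↦ by
      rcases hc a with h | h <;> simp [h]
    rw [card_erase_of_mem h0, hfib 0] at this
    rw [hfdef]
    simp only
    rw [← add_sum_erase _ _ h0, hc0]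
    simpa using this
  have hdvd (x : C) (hx : x ≠ 0) : 2 ^ i ∣ f x := by
    have h1 := hf.dvd_card_mul_sub hx
    rw [hk, add_sub_cancel_left, dvd_sub_left (dvd_mul_right _ _), hC] at h1
    refine IsCoprime.dvd_of_dvd_mul_left ?_ (hiδ.trans h1)
    have : Nat.Coprime (2 ^ i) (p ^ 3) :=
      Nat.Coprime.pow _ _ (Nat.coprime_two_left.2 hodd)
    exact_mod_cast Nat.isCoprime_iff_coprime.2 this
  have hsum : ∑ x, f x = θ + δ * s := by rw [hf.sum_eq, hk]
  have hsq : ∑ x, f x ^ 2 = 8 * (θ + δ * s + θ * (θ + δ)) +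
      ((2 * θ + δ) * f 0 - θ * (θ + δ)) := by
    have h1 := hf.sum_sq_eq
    have h2 := h.mul_sub_one_eq hc hc0 hδ hN hk
    have h3 : δ * N = 8 * (Fintype.card C : ℤ) := by rw [hN, hcard, hC]; push_cast; ring
    have h4 : (Fintype.card C : ℤ) ≠ 0 := by rw [hC]; exact_mod_cast hp0.ne'
    apply mul_left_cancel₀ h4
    subst hk
    linear_combination h1 + δ * h2 + (θ + δ * s + θ * (θ + δ)) * h3
  have hcardC : ((univ : Finset C).card : ℤ) = (p : ℤ) ^ 3 := by
    rw [card_univ, hC]; push_cast; rfl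
  have hi8 : (2 : ℤ) ^ i ∣ 8 := by
    have := pow_dvd_pow (2 : ℤ) hi
    norm_num at this
    exact this
  refine ⟨f 0, hf0 0, hf7, ?_, ?_⟩
  · have h1 := sum_le_of_forall_ne_zero (F := fun x ↦ f x * 8 - f x ^ 2 - (8 - 2 ^ i) * f x)
      fun x hx ↦ by
        rcases (hf0 x).eq_or_lt with h1 | h1
        · simp [← h1]
        · have := Int.le_of_dvd h1 (hdvd x hx)
          nlinarith
    simp only [sum_sub_distrib, ← sum_mul, ← mul_sum, hsum, hsq] at h1
    linarith
  · have h1 := sum_le_of_forall_ne_zero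
      (F := fun x ↦ f x * 8 - f x ^ 2 - (8 - 2 ^ i) * (8 - f x)) fun x hx ↦ by
        rcases (hf8 x).eq_or_lt with h1 | h1
        · simp [h1]
        · have := Int.le_of_dvd (by linarith) (dvd_sub hi8 (hdvd x hx))
          nlinarith
    simp only [sum_sub_distrib, ← sum_mul, ← mul_sum, hsum, hsq, sum_const, nsmul_eq_mul,
      hcardC] at h1
    linarith

theorem endpoint {p : ℕ} (hp : p.Prime) (hodd : Odd p) (hcard : Fintype.card A = 8 * p ^ 3)
    (h : TwoValuedTransform c E k θ δ) (hc : ∀ a, c a = 0 ∨ c a = 1) (hc0 : c 0 = 0)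
    {i j : ℕ} (hi : i ≤ 3) (hj : j ≤ 1) (hδ : δ = 2 ^ i * (p : ℤ) ^ j)
    (hN : δ * N = 8 * (p : ℤ) ^ 3) (hk : k = θ + δ * s) (hs1 : 1 ≤ s) (hsN : s ≤ N)
    (hθ1 : θ ≤ -1) (hθδ : -δ ≤ θ) : s = 1 ∨ s = N ∨ θ = -1 ∨ θ = -δ := by
  have hN' : δ * N = Fintype.card A := by rw [hN, hcard]; push_cast; rfl
  have hδ0 : δ ≠ 0 := by lia
  obtain ⟨d, hd0, hd7, hQ, hQ'⟩ := h.coset_constraints hp hodd hcard hc hc0 hi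
    ⟨_, hδ⟩ hδ0 hN' hk
  exact endpoint_of_constraints hp hodd hi hj hδ hN hs1 hsN hθ1 hθδ hd0 hd7 rfl
    (h.mul_sub_one_eq hc hc0 hδ0 hN' hk) hQ hQ'

theorem degenerate {p : ℕ} (hp : p.Prime) (hodd : Odd p) (hcard : Fintype.card A = 8 * p ^ 3)
    (h : TwoValuedTransform c E k θ δ) (hc : ∀ a, c a = 0 ∨ c a = 1) (hc0 : c 0 = 0)
    (hδ : 0 ≤ δ) {a b : A} (ha : c a = 1) (hb0 : b ≠ 0) (hb : c b = 0) :
    k + θ * (θ + δ) = 0 ∨ θ * (θ + δ) = 0 := by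
  classical
  have hcnn (x : A) : 0 ≤ c x := by rcases hc x with h | h <;> simp [h]
  have hc1 (x : A) : 0 ≤ 1 - c x := by rcases hc x with h | h <;> simp [h]
  have ha0 : a ≠ 0 := by rintro rfl; simp [hc0] at ha
  have hk1 : 1 ≤ k := by
    rw [← h.sum_eq, ← ha]
    exact single_le_sum (fun x _ ↦ hcnn x) (mem_univ a)
  have hk2 : k ≤ Fintype.card A - 2 := by
    have h1 : ∑ x ∈ {0, b}, (1 - c x) ≤ ∑ x, (1 - c x) :=
      sum_le_sum_of_subset_of_nonneg (subset_univ _) fun x _ _ ↦ hc1 x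
    rw [sum_pair hb0.symm, hc0, hb, sum_sub_distrib, h.sum_eq] at h1
    simp at h1
    linarith
  have hE : (E.card : ℤ) ≤ Fintype.card A - 1 := by
    have h1 : E.card < Fintype.card (AddChar A ℂ) := by
      rw [← card_univ]
      exact card_lt_card ⟨subset_univ _, fun h2 ↦ h.zero_notMem (h2 (mem_univ _))⟩
    rw [AddChar.card_eq] at h1
    lia
  have hcount := h.card_mul_apply_zero
  rw [hc0, mul_zero] at hcount
  have hθ1 : θ ≤ -1 := by
    by_contra! hθ
    nlinarith
  have hθδ : -δ ≤ θ := by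
    by_contra! hθ
    nlinarith
  obtain ⟨s, hs⟩ : δ ∣ k - θ := by
    have := h.dvd_card_mul_sub hb0
    rwa [hb, mul_zero, zero_sub, dvd_neg] at this
  have hk : k = θ + δ * s := by linarith
  obtain ⟨N, hN⟩ : δ ∣ Fintype.card A := by
    have := h.dvd_card_mul_sub ha0
    rwa [ha, mul_one, dvd_sub_left ⟨s, hs⟩] at this
  have hN' : δ * N = 8 * (p : ℤ) ^ 3 := by rw [← hN, hcard]; push_cast; rfl
  have hp0 : 0 < (p : ℤ) := by exact_mod_cast hp.pos
  have hv : 0 < δ * N := by rw [hN']; positivity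
  have hδ0 : 0 < δ := lt_of_le_of_ne hδ fun h0 ↦ by simp [← h0] at hv
  have hN0 : 0 < N := pos_of_mul_pos_right hv hδ
  have hs1 : 1 ≤ s := by
    have : 0 < δ * s := by lia
    exact pos_of_mul_pos_right this hδ
  have hsN : s ≤ N := by
    have : δ * s < δ * (N + 1) := by lia
    have := lt_of_mul_lt_mul_left this hδ
    lia
  have hquad := h.mul_sub_one_eq hc hc0 hδ0.ne' hN.symm hk
  obtain ⟨i, j, hi, hj, hδij⟩ : ∃ i j : ℕ, i ≤ 3 ∧ j ≤ 3 ∧ δ = 2 ^ i * (p : ℤ) ^ j := by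
    lift δ to ℕ using hδ
    have h1 : δ ∣ 2 ^ 3 * p ^ 3 := by
      have : (δ : ℤ) ∣ ((2 ^ 3 * p ^ 3 : ℕ) : ℤ) := ⟨N, by push_cast; rw [hN']⟩
      exact_mod_cast this
    obtain ⟨x, y, hx, hy, rfl⟩ := Nat.dvd_mul.1 h1
    obtain ⟨i, hi, rfl⟩ := (Nat.dvd_prime_pow Nat.prime_two).1 hx
    obtain ⟨j, hj, rfl⟩ := (Nat.dvd_prime_pow hp).1 hy
    exact ⟨i, j, hi, hj, by push_cast; rfl⟩
  have hend : s = 1 ∨ s = N ∨ θ = -1 ∨ θ = -δ := by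
    rcases le_or_gt j 1 with hj1 | hj1
    · exact h.endpoint hp hodd hcard hc hc0 hi hj1 hδij hN' hk hs1 hsN hθ1 hθδ
    · obtain ⟨E', hE'⟩ := h.dual hc hc0 hδ0.ne' hN.symm hk
      have hNij : N = 2 ^ (3 - i) * (p : ℤ) ^ (3 - j) := by
        apply mul_left_cancel₀ hδ0.ne'
        rw [hN', hδij, show (2 : ℤ) ^ i * p ^ j * (2 ^ (3 - i) * p ^ (3 - j)) =
          (2 ^ i * 2 ^ (3 - i)) * (p ^ j * p ^ (3 - j)) by ring, ← pow_add, ← pow_add,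
          Nat.add_sub_cancel' hi, Nat.add_sub_cancel' hj]
        norm_num
      have := hE'.endpoint (s := -θ) (N := δ) hp hodd (by rw [AddChar.card_eq, hcard])
        (fun χ ↦ by by_cases hχ : χ ∈ E <;> simp [hχ]) (by simp [h.zero_notMem])
        (Nat.sub_le _ _) (by lia) hNij (by linarith) rfl (by lia) (by lia) (by lia) (by lia)
      lia
  rcases hend with rfl | rfl | rfl | rfl
  · left
    rw [hk]
    have : (θ + δ * 1 + θ * (θ + δ)) * N = 0 := by rw [← hquad]; ring
    exact (mul_eq_zero.1 this).resolve_right hN0.ne'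
  · right
    have h1 : (θ + 1) * (θ + δ) = 0 := by
      have : δ * (s - 1) = θ + δ * s + θ * (θ + δ) :=
        mul_right_cancel₀ hN0.ne' (by linear_combination hquad)
      linear_combination -this
    rcases mul_eq_zero.1 h1 with h2 | h2
    · exfalso; lia
    · rw [h2, mul_zero]
  · have h1 : (δ * (s - 1)) * (s - N) = 0 := by linear_combination hquad
    rcases mul_eq_zero.1 h1 with h2 | h2
    · left; linear_combination hk + h2
    · exfalso
      obtain rfl : s = N := by lia
      lia
  · right; ring

end TwoValuedTransform

end Core

section PartialDifferenceSet

open Finset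

theorem isTrivialPDS_of_forall_mul_mem {D : Finset G} (hreg : IsRegularPDS D)
    (h : ∀ x ∈ D, ∀ y ∈ D, x * y ≠ 1 → x * y ∈ D) : IsTrivialPDS D := by
  left
  refine ⟨{ carrier := ↑D ∪ {1}, one_mem' := by simp, mul_mem' := ?_, inv_mem' := ?_ }, rfl⟩
  · rintro x y (hx | rfl) (hy | rfl)
    · by_cases hxy : x * y = 1
      · exact .inr hxy
      · exact .inl (h x hx y hy hxy)
    · simpa using .inr hx
    · simpa using .inr hy
    · simp
  · rintro x (hx | rfl)
    · exact .inl (hreg.1 x hx)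
    · simp

theorem isTrivialPDS_of_forall_mul_mem_of_notMem {D : Finset G} (hreg : IsRegularPDS D)
    (h : ∀ x ∉ D, x ≠ 1 → ∀ y ∈ D, x * y ∈ D) : IsTrivialPDS D := by
  right
  have h1 : (1 : G) ∈ (↑D : Set G)ᶜ := by simpa using hreg.2
  refine ⟨{ carrier := (↑D)ᶜ, one_mem' := h1, mul_mem' := ?_, inv_mem' := ?_ }, rfl⟩
  · intro x y hx hy
    rcases eq_or_ne x 1 with rfl | hx1
    · simpa using hy
    · intro hxy
      have := h x⁻¹ (fun h' ↦ hx (by simpa using hreg.1 _ h')) (by simpa) _ hxy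
      exact hy (by simpa using this)
  · exact fun hx h' ↦ hx (by simpa using hreg.1 _ h')

theorem pdsReps_eq_card_filter_mul_mem {D : Finset G} {g : G} (hg : g ≠ 1) :
    pdsReps D g = (D.filter fun d ↦ g * d ∈ D).card := by
  refine card_bij' (fun x _ ↦ x.2) (fun d _ ↦ (g * d, d)) ?_ ?_ ?_ ?_
  · rintro ⟨x, y⟩ hx
    simp only [mem_filter, mem_product] at hx ⊢
    obtain ⟨⟨h1, h2⟩, -, rfl⟩ := hx
    simp [h1, h2]
  · intro d hd
    simp only [mem_filter, mem_product] at hd ⊢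
    simp [hd.1, hd.2, hg]
  · rintro ⟨x, y⟩ hx
    simp only [mem_filter] at hx
    obtain ⟨-, -, rfl⟩ := hx
    simp
  · simp

namespace IsPDS

variable {D : Finset G} {v k l m : ℕ}

theorem isTrivialPDS_of_eq_zero (h : IsPDS D v k l 0) (hreg : IsRegularPDS D) :
    IsTrivialPDS D := by
  refine isTrivialPDS_of_forall_mul_mem hreg fun x hx y hy hxy ↦ ?_
  by_contra hD
  have h1 := h.2.2.2 _ hxy hD
  rw [pdsReps_eq_card_filter_mul_mem hxy, card_eq_zero, filter_eq_empty_iff] at h1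
  exact h1 (hreg.1 y hy) (by simpa using hx)

theorem isTrivialPDS_of_eq (h : IsPDS D v k l k) (hreg : IsRegularPDS D) :
    IsTrivialPDS D := by
  refine isTrivialPDS_of_forall_mul_mem_of_notMem hreg fun x hx hx1 y hy ↦ ?_
  have h1 := h.2.2.2 x hx1 hx
  rw [pdsReps_eq_card_filter_mul_mem hx1, ← h.2.1, card_filter_eq_iff] at h1
  exact h1 y hy

/-- Character values of a regular partial difference set satisfy a quadratic equation. -/
theorem charSum_sq (h : IsPDS D v k l m) (hreg : IsRegularPDS D)
    {χ : AddChar (Additive G) ℂ} (hχ : χ ≠ 0) :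
    (∑ d ∈ D, χ (.ofMul d)) ^ 2 = ((l : ℂ) - m) * ∑ d ∈ D, χ (.ofMul d) + (k - m) := by
  have hinv : ∑ d ∈ D, χ (.ofMul d) = ∑ d ∈ D, χ (.ofMul d⁻¹) :=
    sum_bij' (fun d _ ↦ d⁻¹) (fun d _ ↦ d⁻¹) hreg.1 hreg.1 (by simp) (by simp) (by simp)
  have hsum : ∑ g : G, χ (.ofMul g) = 0 :=
    (Equiv.sum_comp Additive.ofMul fun a ↦ χ a).trans (AddChar.sum_eq_zero_iff_ne_zero.2 hχ)
  have hreps (g : G) : (((D.filter fun d ↦ g * d ∈ D).card : ℕ) : ℂ) =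
      m + (l - m) * (if g ∈ D then 1 else 0) + (k - m) * (if g = 1 then 1 else 0) := by
    rcases eq_or_ne g 1 with rfl | hg
    · simp [hreg.2, h.2.1]
    · rw [← pdsReps_eq_card_filter_mul_mem hg]
      by_cases hD : g ∈ D
      · simp [hD, hg, h.2.2.1 g hg hD]
      · simp [hD, hg, h.2.2.2 g hg hD]
  calc (∑ d ∈ D, χ (.ofMul d)) ^ 2
      = ∑ d ∈ D, ∑ x : G, if x ∈ D then χ (.ofMul (x * d⁻¹)) else 0 := by
        rw [sq]
        nth_rewrite 2 [hinv]
        rw [sum_mul_sum, sum_comm]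
        refine sum_congr rfl fun d _ ↦ ?_
        rw [sum_ite_mem, univ_inter]
        exact sum_congr rfl fun x _ ↦ by rw [ofMul_mul, AddChar.map_add_eq_mul]
    _ = ∑ d ∈ D, ∑ g : G, if g * d ∈ D then χ (.ofMul g) else 0 := by
        refine sum_congr rfl fun d _ ↦ ?_
        rw [← Equiv.sum_comp (Equiv.mulRight d)]
        simp
    _ = ∑ g : G, ((D.filter fun d ↦ g * d ∈ D).card : ℂ) * χ (.ofMul g) := by
        rw [sum_comm]
        refine sum_congr rfl fun g _ ↦ ?_
        rw [← sum_filter, sum_const, nsmul_eq_mul]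
    _ = _ := by
        simp_rw [hreps, add_mul, sum_add_distrib, mul_assoc, ← mul_sum, hsum]
        simp

theorem charSum_conj (hreg : IsRegularPDS D) (χ : AddChar (Additive G) ℂ) :
    starRingEnd ℂ (∑ d ∈ D, χ (.ofMul d)) = ∑ d ∈ D, χ (.ofMul d) := by
  rw [map_sum]
  simp_rw [← AddChar.map_neg_eq_conj, ← ofMul_inv]
  exact sum_bij' (fun d _ ↦ d⁻¹) (fun d _ ↦ d⁻¹) hreg.1 hreg.1 (by simp) (by simp) (by simp)

theorem charSum_indicator (D : Finset G) (χ : AddChar (Additive G) ℂ) :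
    ∑ a, ((if a.toMul ∈ D then 1 else 0 : ℤ) : ℂ) * χ a = ∑ d ∈ D, χ (.ofMul d) := by
  rw [← Equiv.sum_comp Additive.ofMul]
  simp [sum_ite_mem]

/-- In a group of even order the character values of a regular partial difference set are
integers. -/
theorem exists_twoValuedTransform (h : IsPDS D v k l m) (hreg : IsRegularPDS D) (hv : Even v)
    (hv0 : 0 < v) :
    ∃ (θ δ : ℤ) (E : Finset (AddChar (Additive G) ℂ)), 0 ≤ δ ∧ (m : ℤ) = k + θ * (θ + δ) ∧
      TwoValuedTransform (fun a : Additive G ↦ if a.toMul ∈ D then 1 else 0) E k θ δ := by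
  classical
  set S : AddChar (Additive G) ℂ → ℂ := fun χ ↦ ∑ d ∈ D, χ (.ofMul d) with hS
  set β : ℤ := l - m with hβ
  set Δ : ℤ := β ^ 2 + 4 * (k - m) with hΔ
  have hcard : Fintype.card (AddChar (Additive G) ℂ) = v := by
    rw [AddChar.card_eq, Fintype.card_additive, h.1]
  have hsq (χ : AddChar (Additive G) ℂ) (hχ : χ ≠ 0) : (2 * S χ - β) ^ 2 = Δ := by
    have := h.charSum_sq hreg hχ
    simp only [hS, hΔ, hβ]
    push_cast
    linear_combination 4 * this
  have hexists : ∃ χ : AddChar (Additive G) ℂ, χ ≠ 0 := by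
    have : Nontrivial (AddChar (Additive G) ℂ) := by
      rw [← Fintype.one_lt_card_iff_nontrivial, hcard]
      obtain ⟨r, rfl⟩ := hv
      lia
    exact exists_ne 0
  have hΔ0 : 0 ≤ Δ := by
    obtain ⟨χ, hχ⟩ := hexists
    obtain ⟨r, hr⟩ := Complex.conj_eq_iff_real.1 (charSum_conj hreg χ)
    have h1 := hsq χ hχ
    simp only [hS, hr] at h1
    have h2 : (2 * r - β) ^ 2 = (Δ : ℝ) := by exact_mod_cast h1
    have h3 : (0 : ℝ) ≤ Δ := by rw [← h2]; positivity
    exact_mod_cast h3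
  obtain ⟨q, hq⟩ : ∃ q : ℂ, q ^ 2 = Δ := by
    obtain ⟨q, hq⟩ := IsAlgClosed.exists_pow_nat_eq (Δ : ℂ) (n := 2) (by norm_num)
    exact ⟨q, hq⟩
  set E' : Finset (AddChar (Additive G) ℂ) := univ.filter fun χ ↦ χ ≠ 0 ∧ 2 * S χ - β = q
  have hval (χ : AddChar (Additive G) ℂ) : 2 * S χ - β =
      -q + 2 * q * (if χ ∈ E' then 1 else 0) + (2 * k - β + q) * (if χ = 0 then 1 else 0) := by
    by_cases hχ : χ = 0
    · subst hχ
      simp [E', hS, h.2.1]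
    · rcases sq_eq_sq_iff_eq_or_eq_neg.1 ((hsq χ hχ).trans hq.symm) with h1 | h1
      · have : χ ∈ E' := by simp [E', hχ, h1]
        simp [hχ, h1, this]; ring
      · by_cases h2 : χ ∈ E'
        · simp only [E', mem_filter, mem_univ, true_and] at h2
          have h3 : q = 0 := by linear_combination (h1 - h2.2) / 2
          simp [hχ, h1, h3]
        · simp [hχ, h1, h2]
  have hsum : ∑ χ, S χ = 0 := by
    have h1 := AddChar.sum_charSum_mul
      (fun a : Additive G ↦ ((if a.toMul ∈ D then 1 else 0 : ℤ) : ℂ)) 0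
    simp_rw [charSum_indicator] at h1
    simpa [hreg.2] using h1
  have hT : q * ((2 * E'.card - v + 1 : ℤ) : ℂ) = ((-(2 * k - β + v * β) : ℤ) : ℂ) := by
    have h1 : ∑ χ, (2 * S χ - β) = -(v * β) := by
      rw [sum_sub_distrib, ← mul_sum, hsum]
      simp [hcard]
    simp_rw [hval, sum_add_distrib, ← mul_sum] at h1
    simp [hcard] at h1
    push_cast
    linear_combination h1
  have hT0 : (2 * E'.card - v + 1 : ℤ) ≠ 0 := by
    obtain ⟨r, rfl⟩ := hv
    lia
  obtain ⟨t, ht0, ht⟩ : ∃ t : ℤ, 0 ≤ t ∧ Δ = t ^ 2 := by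
    have h1 : (2 * E'.card - v + 1 : ℤ) ^ 2 * Δ = (-(2 * k - β + v * β)) ^ 2 := by
      have : (((2 * E'.card - v + 1 : ℤ) ^ 2 * Δ : ℤ) : ℂ) =
          (((-(2 * k - β + v * β)) ^ 2 : ℤ) : ℂ) := by
        rw [Int.cast_pow (-(2 * k - β + v * β)), ← hT, Int.cast_mul, ← hq, Int.cast_pow]
        ring
      exact_mod_cast this
    obtain ⟨t, ht⟩ := (Int.pow_dvd_pow_iff two_ne_zero).1 ⟨Δ, h1.symm⟩
    refine ⟨|t|, abs_nonneg t, ?_⟩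
    rw [ht, mul_pow] at h1
    rw [sq_abs]
    exact mul_left_cancel₀ (pow_ne_zero 2 hT0) h1
  obtain ⟨θ, hθ⟩ : ∃ θ, β = 2 * θ + t := by
    have h1 : Even (β ^ 2 - t ^ 2) := ⟨-2 * (k - m), by rw [← ht]; ring⟩
    have h2 : Even (β - t) := by
      rw [Int.even_sub, Int.even_pow' two_ne_zero, Int.even_pow' two_ne_zero] at h1
      rwa [Int.even_sub]
    obtain ⟨θ, hθ⟩ := h2
    exact ⟨θ, by lia⟩
  refine ⟨θ, t, univ.filter fun χ ↦ χ ≠ 0 ∧ S χ = θ + t, ht0, ?_, by simp, ?_, fun χ hχ ↦ ?_⟩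
  · rw [hΔ, hθ] at ht
    linarith
  · rw [← Equiv.sum_comp Additive.ofMul]
    simp [h.2.1]
  · rw [charSum_indicator]
    change S χ = _
    by_cases h1 : S χ = θ + t
    · simp [hχ, h1]
    · have h2 := hsq χ hχ
      rw [ht, hθ] at h2
      push_cast at h2
      have h3 : (S χ - (θ + t)) * (S χ - θ) = 0 := by linear_combination h2 / 4
      rcases mul_eq_zero.1 h3 with h4 | h4
      · exact absurd (sub_eq_zero.1 h4) h1
      · simp [Set.indicator_apply, sub_eq_zero.1 h4]

end IsPDS

end PartialDifferenceSet

/-- Every regular partial difference set in an Abelian group of order `8p^3`,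
`p` an odd prime, is trivial. -/
theorem pds_8p3_trivial (p : ℕ) (hp : p.Prime) (hodd : Odd p)
    {G : Type*} [CommGroup G] [DecidableEq G] [Fintype G]
    (D : Finset G) (k l m : ℕ)
    (hPDS : IsPDS D (8 * p ^ 3) k l m) (hreg : IsRegularPDS D) :
    IsTrivialPDS D := by
  by_cases hD : ∃ a, a ∈ D
  swap
  · push Not at hD
    exact isTrivialPDS_of_forall_mul_mem hreg fun x hx ↦ absurd hx (hD x)
  by_cases hD' : ∃ b, b ≠ 1 ∧ b ∉ D
  swap
  · push Not at hD'
    exact isTrivialPDS_of_forall_mul_mem hreg fun x _ y _ hxy ↦ hD' _ hxy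
  obtain ⟨a, ha⟩ := hD
  obtain ⟨b, hb1, hb⟩ := hD'
  obtain ⟨θ, δ, E, hδ, hm, hE⟩ := hPDS.exists_twoValuedTransform hreg
    ((by decide : Even 8).mul_right _) (by have := hp.pos; positivity)
  have := hE.degenerate (a := .ofMul a) (b := .ofMul b) hp hodd
    (by rw [Fintype.card_additive, hPDS.1])
    (fun x ↦ by by_cases hx : x.toMul ∈ D <;> simp [hx]) (by simpa using hreg.2) hδ
    (by simpa using ha) (by simpa using hb1) (by simpa using hb)
  rcases this with h | h
  · obtain rfl : m = 0 := by lia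
    exact hPDS.isTrivialPDS_of_eq_zero hreg
  · obtain rfl : m = k := by lia
    exact hPDS.isTrivialPDS_of_eq hreg
end

section
/- Let p ≥ 5 be a prime, let G be an Abelian group isomorphic to (ℤ/2ℤ)^3 × (ℤ/pℤ)^3, and let D be a regular (8p^3,k,λ,μ)-partial difference set in G such that Δ = (λ−μ)^2 + 4(k−μ) is a perfect square. Let N = {x ∈ G : x^2 = e} be the Sylow 2-subgroup of G. Then for every element g ∈ G of order p and every integer s with 1 ≤ s ≤ p−1, the coset Ng = {a·g : a ∈ N} and the coset Ng^s satisfy |D ∩ Ng| = |D ∩ Ng^s|. -/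
variable {G : Type*} [CommGroup G] [DecidableEq G] [Fintype G]

/-- The formal sum of a finite subset of `G` in the group algebra. -/
noncomputable def groupSum (R : Type*) [Semiring R] (S : Finset G) : MonoidAlgebra R G :=
  ∑ d ∈ S, MonoidAlgebra.single d 1

theorem coeff_groupSum {G : Type*} [DecidableEq G] (R : Type*) [Semiring R] (S : Finset G)
    (g : G) :
    (groupSum R S).coeff g = if g ∈ S then 1 else 0 := by
  simp [groupSum, MonoidAlgebra.coeff_sum, Finsupp.finsetSum_apply, Finsupp.single_apply]

theorem mul_groupSum_univ {G R : Type*} [CommGroup G] [Fintype G] [CommRing R]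
    (X : MonoidAlgebra R G) :
    ∃ c : R, X * groupSum R Finset.univ = c • groupSum R Finset.univ := by
  induction X using MonoidAlgebra.induction_linear with
  | zero => exact ⟨0, by simp⟩
  | add x y hx hy =>
    obtain ⟨a, ha⟩ := hx
    obtain ⟨b, hb⟩ := hy
    exact ⟨a + b, by rw [add_mul, ha, hb, add_smul]⟩
  | single h r =>
    refine ⟨r, ?_⟩
    simp only [groupSum, Finset.mul_sum, MonoidAlgebra.single_mul_single, mul_one,
      Finset.smul_sum, MonoidAlgebra.smul_single, smul_eq_mul]
    exact Fintype.sum_equiv (Equiv.mulLeft h) _ _ fun _ => rfl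

theorem add_smul_groupSum_univ_pow {G R : Type*} [CommGroup G] [Fintype G] [CommRing R]
    (a b : R) (n : ℕ) :
    ∃ c : R, (a • (1 : MonoidAlgebra R G) + b • groupSum R Finset.univ) ^ n =
      a ^ n • (1 : MonoidAlgebra R G) + c • groupSum R Finset.univ := by
  induction n with
  | zero => exact ⟨0, by simp⟩
  | succ n ih =>
    obtain ⟨c, hc⟩ := ih
    obtain ⟨e, he⟩ := mul_groupSum_univ
      (a ^ n • (1 : MonoidAlgebra R G) + c • groupSum R Finset.univ)
    refine ⟨c * a + b * e, ?_⟩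
    rw [pow_succ, hc, mul_add, mul_smul_comm, mul_smul_comm, he, mul_one, pow_succ]
    module

theorem card_filter_mul_eq_pdsReps {G : Type*} [CommGroup G] [DecidableEq G] {D : Finset G}
    (hinv : ∀ d ∈ D, d⁻¹ ∈ D) {g : G}
    (hg : g ≠ 1) : ((D ×ˢ D).filter fun x => x.1 * x.2 = g).card = pdsReps D g := by
  refine Finset.card_bij' (fun x _ => (x.1, x.2⁻¹)) (fun x _ => (x.1, x.2⁻¹)) ?_ ?_ ?_ ?_
  · rintro ⟨a, b⟩ h
    simp only [Finset.mem_filter, Finset.mem_product] at h ⊢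
    refine ⟨⟨h.1.1, hinv _ h.1.2⟩, ?_, by simpa using h.2⟩
    rintro rfl
    exact hg (by simpa using h.2.symm)
  · rintro ⟨a, b⟩ h
    simp only [Finset.mem_filter, Finset.mem_product] at h ⊢
    exact ⟨⟨h.1.1, hinv _ h.1.2⟩, h.2.2⟩
  · simp
  · simp

theorem card_filter_mul_eq_one {G : Type*} [CommGroup G] [DecidableEq G] {D : Finset G}
    (hinv : ∀ d ∈ D, d⁻¹ ∈ D) :
    ((D ×ˢ D).filter fun x => x.1 * x.2 = 1).card = D.card := by
  symm
  refine Finset.card_bij' (fun d _ => (d, d⁻¹)) (fun x _ => x.1) ?_ ?_ ?_ ?_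
  · intro d hd
    simp [hd, hinv d hd]
  · rintro ⟨a, b⟩ h
    simp only [Finset.mem_filter, Finset.mem_product] at h
    exact h.1.1
  · simp
  · rintro ⟨a, b⟩ h
    simp only [Finset.mem_filter, Finset.mem_product] at h
    simp [inv_eq_of_mul_eq_one_right h.2]

theorem IsPDS.groupSum_mul_self {R : Type*} [CommRing R] {D : Finset G} {v k l m : ℕ}
    (hD : IsPDS D v k l m) (hreg : IsRegularPDS D) :
    groupSum R D * groupSum R D = ((k : R) - m) • (1 : MonoidAlgebra R G) +
      ((l : R) - m) • groupSum R D + (m : R) • groupSum R Finset.univ := by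
  obtain ⟨-, hk, hl, hm⟩ := hD
  have hmul : ∀ g, (groupSum R D * groupSum R D).coeff g =
      (((D ×ˢ D).filter fun x => x.1 * x.2 = g).card : R) := by
    intro g
    simp only [groupSum, Finset.sum_mul_sum, MonoidAlgebra.single_mul_single, mul_one]
    rw [← Finset.sum_product', MonoidAlgebra.coeff_sum, Finsupp.finsetSum_apply]
    simp [Finsupp.single_apply]
  ext g
  rw [hmul]
  by_cases hg : g = 1
  · subst hg
    simp [card_filter_mul_eq_one hreg.1, hk, coeff_groupSum, hreg.2]
  · rw [card_filter_mul_eq_pdsReps hreg.1 hg]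
    by_cases hgD : g ∈ D
    · simp [hl g hg hgD, coeff_groupSum, hgD, MonoidAlgebra.one_def, Ne.symm hg]
    · simp [hm g hg hgD, coeff_groupSum, hgD, MonoidAlgebra.one_def, Ne.symm hg]

theorem coeff_groupSum_pow_char {q : ℕ} [Fact q.Prime] (hq : (Fintype.card G).Coprime q)
    (D : Finset G) (g : G) :
    (groupSum (ZMod q) D ^ q).coeff (g ^ q) = if g ∈ D then 1 else 0 := by
  have : CharP (MonoidAlgebra (ZMod q) G) q :=
    charP_of_injective_algebraMap (algebraMap (ZMod q) (MonoidAlgebra (ZMod q) G)).injective q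
  have hinj : Function.Injective fun x : G => x ^ q :=
    (powCoprime (by rwa [Nat.card_eq_fintype_card])).injective
  rw [groupSum, sum_pow_char, MonoidAlgebra.coeff_sum, Finsupp.finsetSum_apply]
  simp [MonoidAlgebra.single_pow, Finsupp.single_apply, hinj.eq_iff]

/-- Every prime coprime to `2 * |G|` is a numerical multiplier of a regular partial difference
set whose discriminant is a perfect square. -/
theorem IsPDS.pow_prime_mem_iff {D : Finset G} {v k l m : ℕ} (hD : IsPDS D v k l m)
    (hreg : IsRegularPDS D) (hsq : ∃ t : ℤ, ((l : ℤ) - m) ^ 2 + 4 * ((k : ℤ) - m) = t ^ 2)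
    {q : ℕ} (hqp : q.Prime) (hodd : Odd q) (hq : (Fintype.card G).Coprime q) (g : G) :
    g ^ q ∈ D ↔ g ∈ D := by
  have : Fact q.Prime := ⟨hqp⟩
  have : CharP (MonoidAlgebra (ZMod q) G) q :=
    charP_of_injective_algebraMap (algebraMap (ZMod q) (MonoidAlgebra (ZMod q) G)).injective q
  have hinj : Function.Injective fun x : G => x ^ q :=
    (powCoprime (by rwa [Nat.card_eq_fintype_card])).injective
  obtain ⟨t, ht⟩ := hsq
  have ht' : ((l : ZMod q) - m) ^ 2 + 4 * ((k : ZMod q) - m) = (t : ZMod q) ^ 2 := by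
    exact_mod_cast congrArg (Int.cast : ℤ → ZMod q) ht
  have h2 : (2 : ZMod q) ≠ 0 := by
    intro h
    have h' : ((2 : ℕ) : ZMod q) = 0 := by exact_mod_cast h
    rw [ZMod.natCast_eq_zero_iff, Nat.prime_dvd_prime_iff_eq hqp Nat.prime_two] at h'
    subst h'
    exact absurd hodd (by decide)
  set S := groupSum (ZMod q) D with hS
  set J := groupSum (ZMod q) (Finset.univ : Finset G) with hJ
  set β : ZMod q := (l : ZMod q) - m with hβ
  set E : MonoidAlgebra (ZMod q) G := (2 : ZMod q) • S - β • 1 with hE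
  have hE2 : E ^ 2 = ((t : ZMod q) ^ 2) • (1 : MonoidAlgebra (ZMod q) G) +
      (4 * (m : ZMod q)) • J := by
    have h := hD.groupSum_mul_self (R := ZMod q) hreg
    rw [← hS, ← hJ, ← hβ] at h
    have : E ^ 2 = (4 : ZMod q) • (S * S) - (4 * β) • S +
        β ^ 2 • (1 : MonoidAlgebra (ZMod q) G) := by
      rw [hE, sq, sub_mul, mul_sub, mul_sub]
      simp only [smul_mul_assoc, mul_smul_comm, one_mul, mul_one]
      module
    rw [this, h, ← ht']
    module
  have hEq : E ^ q = (2 : ZMod q) • S ^ q - β • 1 := by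
    rw [hE, sub_pow_char, smul_pow, smul_pow, ZMod.pow_card, ZMod.pow_card, one_pow]
  obtain ⟨n, hn⟩ := hodd
  obtain ⟨c, hc⟩ := add_smul_groupSum_univ_pow (G := G) ((t : ZMod q) ^ 2) (4 * (m : ZMod q)) n
  obtain ⟨e, he⟩ := mul_groupSum_univ E
  have key : (2 : ZMod q) • S ^ q - β • 1 = (t : ZMod q) ^ (2 * n) • E + (c * e) • J := by
    have hpow : E ^ q = E * (E ^ 2) ^ n := by rw [← pow_mul, ← pow_succ', ← hn]
    rw [← hEq, hpow, hE2, hc, mul_add, mul_smul_comm, mul_smul_comm, he,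
      mul_one, smul_smul, ← pow_mul]
  have coeff_key : ∀ x : G, 2 * (if x ∈ D then (1 : ZMod q) else 0) - β * (if x = 1 then 1 else 0)
      = (t : ZMod q) ^ (2 * n) * (2 * (if x ^ q ∈ D then 1 else 0) - β * (if x = 1 then 1 else 0))
        + c * e := by
    intro x
    have h := congrArg (fun X => X.coeff (x ^ q)) key
    have hx : (1 : G) = x ^ q ↔ x = 1 := by
      rw [eq_comm]
      exact ⟨fun h => hinj (by simpa using h), fun h => by simp [h]⟩
    have h1 := coeff_groupSum_pow_char hq D x
    simpa [hE, h1, hS, hJ, coeff_groupSum, MonoidAlgebra.one_def, Finsupp.single_apply, hx] using h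
  have ind : ∀ (P Q : Prop) [Decidable P] [Decidable Q],
      2 * (if P then (1 : ZMod q) else 0) = 2 * (if Q then 1 else 0) → (Q ↔ P) := by
    intro P Q _ _ h
    have h := mul_left_cancel₀ h2 h
    by_cases hP : P <;> by_cases hQ : Q <;> simp_all
  by_cases hg : g = 1
  · simp [hg]
  by_cases ht0 : (t : ZMod q) ^ (2 * n) = 0
  · have hgq : g ^ q ≠ 1 := fun h => hg (hinj (by simpa using h))
    have h1 := coeff_key g
    have h3 := coeff_key (g ^ q)
    rw [ht0] at h1 h3
    apply ind
    simp only [hg, hgq, if_false, mul_zero, zero_mul, sub_zero, zero_add] at h1 h3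
    rw [h1, h3]
  · have ht1 : (t : ZMod q) ^ (2 * n) = 1 := by
      have := ZMod.pow_card_sub_one_eq_one (p := q) (a := (t : ZMod q))
        (by rintro h; exact ht0 (by rw [h, zero_pow (by have := hqp.two_le; omega)]))
      rwa [show q - 1 = 2 * n by omega] at this
    have h1 := coeff_key 1
    have h3 := coeff_key g
    rw [ht1] at h1 h3
    simp only [hreg.2, one_pow, if_true, if_false, mul_zero, one_mul, mul_one] at h1
    have hce : c * e = 0 := by linear_combination -h1
    apply ind
    simpa [hg, hce] using h3

theorem exists_prime_gt_modEq {p s : ℕ} (hp : p.Prime) (hs : s.Coprime p) :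
    ∃ q, p < q ∧ q.Prime ∧ q ≡ s [MOD p] := by
  have : NeZero p := ⟨hp.ne_zero⟩
  obtain ⟨q, hq, hqp, h⟩ := Nat.forall_exists_prime_gt_and_eq_mod
    ((ZMod.isUnit_iff_coprime s p).2 hs) p
  exact ⟨q, hq, hqp, (ZMod.natCast_eq_natCast_iff _ _ _).1 h⟩

/-- Observation (O): for a regular PDS with square `Δ` in
`G ≅ (ℤ/2)^3 × (ℤ/p)^3`, the number of elements of `D` in the coset `Ng` of
the Sylow 2-subgroup `N` equals that in `Ng^s`, for `g` of order `p` and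
`1 ≤ s ≤ p-1`. -/
theorem pds_coset_counts_equal (p : ℕ) (hp : p.Prime) (hp5 : 5 ≤ p)
    {G : Type*} [CommGroup G] [DecidableEq G] [Fintype G]
    (hiso : Nonempty (G ≃* Multiplicative
      ((ZMod 2 × ZMod 2 × ZMod 2) × (ZMod p × ZMod p × ZMod p))))
    (D : Finset G) (k l m : ℕ)
    (hPDS : IsPDS D (8 * p ^ 3) k l m) (hreg : IsRegularPDS D)
    (hsq : ∃ t : ℤ, ((l : ℤ) - m) ^ 2 + 4 * ((k : ℤ) - m) = t ^ 2)
    (N : Finset G) (hN : N = Finset.univ.filter (fun x : G => x ^ 2 = 1))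
    (g : G) (hg : orderOf g = p) (s : ℕ) (hs1 : 1 ≤ s) (hs2 : s ≤ p - 1) :
    (D ∩ N.image (fun a => a * g)).card =
      (D ∩ N.image (fun a => a * g ^ s)).card := by
  obtain ⟨q, hpq, hqp, hqs⟩ := exists_prime_gt_modEq hp
    (Nat.coprime_of_lt_prime (n := s) (by omega) (by omega) hp).symm
  have hodd : Odd q := hqp.odd_of_ne_two (by omega)
  have hcop : (Fintype.card G).Coprime q := by
    rw [hPDS.1]
    have h2 : Nat.Coprime 2 q := (Nat.coprime_primes Nat.prime_two hqp).2 (by omega)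
    have hpq' : p.Coprime q := (Nat.coprime_primes hp hqp).2 hpq.ne
    exact Nat.Coprime.mul_left (h2.pow_left 3) (hpq'.pow_left 3)
  have hgq : g ^ q = g ^ s := pow_eq_pow_iff_modEq.2 (hg ▸ hqs)
  have hcount : ∀ x : G, (D ∩ N.image fun a => a * x).card =
      (N.filter fun a => a * x ∈ D).card := by
    intro x
    rw [Finset.inter_comm, ← Finset.filter_mem_eq_inter, Finset.filter_image,
      Finset.card_image_of_injective _ (mul_left_injective x)]
  rw [hcount, hcount]
  congr 1
  refine Finset.filter_congr fun a ha => ?_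
  have ha2 : a ^ 2 = 1 := by simpa [hN] using ha
  obtain ⟨n, hn⟩ := hodd
  have haq : a ^ q = a := by rw [hn, pow_succ, pow_mul, ha2, one_pow, one_mul]
  rw [← hPDS.pow_prime_mem_iff hreg hsq hqp ⟨n, hn⟩ hcop (a * g), mul_pow, haq, hgq]
end

section
/- Let p be a positive integer such that 16p − 7 is a perfect square. Then there exists a nonnegative integer y such that p = 4y² + 3y + 1 or p = 4y² + 5y + 2. -/
/-- If `16p - 7` is a perfect square for a positive integer `p`, then
`p = 4y² + 3y + 1` or `p = 4y² + 5y + 2` for some nonnegative integer `y`. -/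
theorem sixteen_p_minus_seven_square (p : ℕ) (hp : 0 < p)
    (hsq : ∃ t : ℤ, (t : ℤ) ^ 2 = 16 * (p : ℤ) - 7) :
    ∃ y : ℕ, p = 4 * y ^ 2 + 3 * y + 1 ∨ p = 4 * y ^ 2 + 5 * y + 2 := by
  obtain ⟨t, ht⟩ := hsq
  have hn : t.natAbs ^ 2 + 7 = 16 * p := by
    zify
    rw [sq_abs]
    linarith
  generalize t.natAbs = n at hn
  obtain ⟨y, r, hr, rfl⟩ : ∃ y r, r < 8 ∧ n = 8 * y + r :=
    ⟨n / 8, n % 8, Nat.mod_lt _ (by norm_num), (Nat.div_add_mod n 8).symm⟩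
  refine ⟨y, ?_⟩
  ring_nf at hn ⊢
  interval_cases r <;> omega
end
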